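/- Let p : ℝ → ℝ be continuous and let u₁, u₂ : ℝ → ℝ be twice differentiable solutions of Hill's equation ü + p(t)u = 0 with Wronskian u₁u̇₂ − u₂u̇₁ identically equal to 1. Define the planar vector fields Y₁ = V_{u₁²}, Y₂ = V_{u₁u₂}, Y₃ = V_{u₂²}, where V_a(t,x) = (a(t), (ȧ(t)/2)x). Then the pointwise Lie brackets satisfy the sl(2,ℝ) commutation relations: [Y₁,Y₂] = Y₁, [Y₁,Y₃] = 2Y₂, [Y₂,Y₃] = Y₃ (as maps ℝ² → ℝ²). -/

import Mathlib

/-- The derivative of the planar field `(t, x) ↦ (a t, (ȧ t / 2) x)`. -/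
theorem fderiv_planarField_apply {a : ℝ → ℝ} (ha : Differentiable ℝ a)
    (ha' : Differentiable ℝ (deriv a)) (q v : ℝ × ℝ) :
    fderiv ℝ (fun q : ℝ × ℝ => (a q.1, deriv a q.1 / 2 * q.2)) q v =
      (deriv a q.1 * v.1, deriv (deriv a) q.1 / 2 * q.2 * v.1 + deriv a q.1 / 2 * v.2) := by
  have hfst : HasFDerivAt (fun q : ℝ × ℝ => q.1) (ContinuousLinearMap.fst ℝ ℝ ℝ) q :=
    hasFDerivAt_fst
  have hsnd : HasFDerivAt (fun q : ℝ × ℝ => q.2) (ContinuousLinearMap.snd ℝ ℝ ℝ) q :=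
    hasFDerivAt_snd
  have h₁ := (ha q.1).hasDerivAt.comp_hasFDerivAt q hfst
  have h₂ := (((ha' q.1).hasDerivAt.div_const 2).comp_hasFDerivAt q hfst).mul hsnd
  have h := (h₁.prodMk h₂).fderiv
  refine (congrArg (fun L => L v) h).trans ?_
  ext
  · simp
  · simp
    ring

/-- The Lie bracket of the planar fields attached to `a` and `b`. -/
theorem lieBracket_planarField {a b : ℝ → ℝ} (ha : Differentiable ℝ a)
    (ha' : Differentiable ℝ (deriv a)) (hb : Differentiable ℝ b)
    (hb' : Differentiable ℝ (deriv b)) (q : ℝ × ℝ) :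
    fderiv ℝ (fun q : ℝ × ℝ => (b q.1, deriv b q.1 / 2 * q.2)) q
        (a q.1, deriv a q.1 / 2 * q.2) -
      fderiv ℝ (fun q : ℝ × ℝ => (a q.1, deriv a q.1 / 2 * q.2)) q
        (b q.1, deriv b q.1 / 2 * q.2) =
      (a q.1 * deriv b q.1 - b q.1 * deriv a q.1,
        (a q.1 * deriv (deriv b) q.1 - b q.1 * deriv (deriv a) q.1) / 2 * q.2) := by
  rw [fderiv_planarField_apply ha ha', fderiv_planarField_apply hb hb']
  ext <;> simp <;> ring

theorem deriv_fun_mul_eq {f g : ℝ → ℝ} (hf : Differentiable ℝ f) (hg : Differentiable ℝ g) :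
    deriv (fun t => f t * g t) = fun t => deriv f t * g t + f t * deriv g t :=
  funext fun t => ((hf t).hasDerivAt.mul (hg t).hasDerivAt).deriv

theorem differentiable_deriv_fun_mul {f g : ℝ → ℝ} (hf : Differentiable ℝ f)
    (hf' : Differentiable ℝ (deriv f)) (hg : Differentiable ℝ g)
    (hg' : Differentiable ℝ (deriv g)) : Differentiable ℝ (deriv fun t => f t * g t) := by
  rw [deriv_fun_mul_eq hf hg]
  exact (hf'.mul hg).add (hf.mul hg')

theorem deriv_deriv_fun_mul {f g : ℝ → ℝ} (hf : Differentiable ℝ f)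
    (hf' : Differentiable ℝ (deriv f)) (hg : Differentiable ℝ g)
    (hg' : Differentiable ℝ (deriv g)) (t : ℝ) :
    deriv (deriv fun t => f t * g t) t =
      deriv (deriv f) t * g t + 2 * (deriv f t * deriv g t) + f t * deriv (deriv g) t := by
  rw [deriv_fun_mul_eq hf hg]
  refine ((((hf' t).hasDerivAt.mul (hg t).hasDerivAt).add
    ((hf t).hasDerivAt.mul (hg' t).hasDerivAt)).deriv).trans ?_
  ring

/-- If `u₁, u₂` are twice differentiable solutions of Hill's equation
`ü + p(t)u = 0` with Wronskian identically `1`, then the planar vector fields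
`Y₁ = V_{u₁²}`, `Y₂ = V_{u₁u₂}`, `Y₃ = V_{u₂²}` (where `V_a(t,x) = (a(t), (ȧ(t)/2)x)`)
satisfy the `sl(2,ℝ)` commutation relations `[Y₁,Y₂] = Y₁`, `[Y₁,Y₃] = 2Y₂`,
`[Y₂,Y₃] = Y₃` with respect to the pointwise Lie bracket. -/
theorem sl2_commutation_relations_of_hill_symmetry_fields
    (p : ℝ → ℝ) (hp : Continuous p)
    (u₁ u₂ : ℝ → ℝ)
    (hu₁ : Differentiable ℝ u₁) (hu₁' : Differentiable ℝ (deriv u₁))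
    (hu₂ : Differentiable ℝ u₂) (hu₂' : Differentiable ℝ (deriv u₂))
    (hHill₁ : ∀ t : ℝ, deriv (deriv u₁) t + p t * u₁ t = 0)
    (hHill₂ : ∀ t : ℝ, deriv (deriv u₂) t + p t * u₂ t = 0)
    (hW : ∀ t : ℝ, u₁ t * deriv u₂ t - u₂ t * deriv u₁ t = 1)
    (V : (ℝ → ℝ) → (ℝ × ℝ → ℝ × ℝ))
    (hV : V = fun a q => (a q.1, deriv a q.1 / 2 * q.2))
    (bracket : (ℝ × ℝ → ℝ × ℝ) → (ℝ × ℝ → ℝ × ℝ) → (ℝ × ℝ → ℝ × ℝ))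
    (hbracket : bracket = fun X Y q => fderiv ℝ Y q (X q) - fderiv ℝ X q (Y q))
    (Y₁ Y₂ Y₃ : ℝ × ℝ → ℝ × ℝ)
    (hY₁ : Y₁ = V (fun t => u₁ t ^ 2))
    (hY₂ : Y₂ = V (fun t => u₁ t * u₂ t))
    (hY₃ : Y₃ = V (fun t => u₂ t ^ 2)) :
    bracket Y₁ Y₂ = Y₁ ∧
    bracket Y₁ Y₃ = (fun q => (2 : ℝ) • Y₂ q) ∧
    bracket Y₂ Y₃ = Y₃ := by
  have key : ∀ {f g h k : ℝ → ℝ}, Differentiable ℝ f → Differentiable ℝ (deriv f) →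
      Differentiable ℝ g → Differentiable ℝ (deriv g) → Differentiable ℝ h →
      Differentiable ℝ (deriv h) → Differentiable ℝ k → Differentiable ℝ (deriv k) →
      ∀ q, bracket (V fun t => f t * g t) (V fun t => h t * k t) q =
        (f q.1 * g q.1 * deriv (fun t => h t * k t) q.1 -
            h q.1 * k q.1 * deriv (fun t => f t * g t) q.1,
          (f q.1 * g q.1 * deriv (deriv fun t => h t * k t) q.1 -
            h q.1 * k q.1 * deriv (deriv fun t => f t * g t) q.1) / 2 * q.2) := by
    intro f g h k hf hf' hg hg' hh hh' hk hk' q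
    rw [hbracket, hV]
    exact lieBracket_planarField (hf.mul hg) (differentiable_deriv_fun_mul hf hf' hg hg')
      (hh.mul hk) (differentiable_deriv_fun_mul hh hh' hk hk') q
  simp only [pow_two] at hY₁ hY₃
  subst hY₁ hY₂ hY₃
  refine ⟨funext fun q => ?_, funext fun q => ?_, funext fun q => ?_⟩
  · rw [key hu₁ hu₁' hu₁ hu₁' hu₁ hu₁' hu₂ hu₂', hV]
    have e₁ := hHill₁ q.1
    have e₂ := hHill₂ q.1
    have w := hW q.1
    simp only [deriv_deriv_fun_mul hu₁ hu₁' hu₁ hu₁', deriv_deriv_fun_mul hu₁ hu₁' hu₂ hu₂']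
    simp only [deriv_fun_mul_eq hu₁ hu₁, deriv_fun_mul_eq hu₁ hu₂]
    rw [eq_neg_of_add_eq_zero_left e₁, eq_neg_of_add_eq_zero_left e₂]
    ext
    · linear_combination u₁ q.1 ^ 2 * w
    · linear_combination u₁ q.1 * deriv u₁ q.1 * q.2 * w
  · rw [key hu₁ hu₁' hu₁ hu₁' hu₂ hu₂' hu₂ hu₂', hV]
    have e₁ := hHill₁ q.1
    have e₂ := hHill₂ q.1
    have w := hW q.1
    simp only [deriv_deriv_fun_mul hu₁ hu₁' hu₁ hu₁', deriv_deriv_fun_mul hu₂ hu₂' hu₂ hu₂']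
    simp only [deriv_fun_mul_eq hu₁ hu₁, deriv_fun_mul_eq hu₁ hu₂, deriv_fun_mul_eq hu₂ hu₂]
    rw [eq_neg_of_add_eq_zero_left e₁, eq_neg_of_add_eq_zero_left e₂]
    ext
    · simp only [Prod.smul_mk, smul_eq_mul]
      linear_combination 2 * u₁ q.1 * u₂ q.1 * w
    · simp only [Prod.smul_mk, smul_eq_mul]
      linear_combination (deriv u₁ q.1 * u₂ q.1 + u₁ q.1 * deriv u₂ q.1) * q.2 * w
  · rw [key hu₁ hu₁' hu₂ hu₂' hu₂ hu₂' hu₂ hu₂', hV]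
    have e₁ := hHill₁ q.1
    have e₂ := hHill₂ q.1
    have w := hW q.1
    simp only [deriv_deriv_fun_mul hu₁ hu₁' hu₂ hu₂', deriv_deriv_fun_mul hu₂ hu₂' hu₂ hu₂']
    simp only [deriv_fun_mul_eq hu₁ hu₂, deriv_fun_mul_eq hu₂ hu₂]
    rw [eq_neg_of_add_eq_zero_left e₁, eq_neg_of_add_eq_zero_left e₂]
    ext
    · linear_combination u₂ q.1 ^ 2 * w
    · linear_combination u₂ q.1 * deriv u₂ q.1 * q.2 * w
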